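/- With notation as in the context, let s be a positive integer. (1) If ρ = 1, then reg I^s = sd + n − 1 for all s ≥ 1. (2) If ρ = 2, then reg I^s = sd if and only if (n−1)/σ₂ + 1 ≤ s. -/

import Mathlib

open MvPolynomial

/-!
Common setup: `R = k[x,y]` (with `x = X 0`, `y = X 1`),
`S = R[T₁,…,T_m] = k[x,y,T₀,…,T_{m-1}]` (`m = m2 + 2`, variables `Fin 2 ⊕ Fin m`,
`x = X (inl 0)`, `y = X (inl 1)`, `Tᵢ = X (inr i)`, 0-indexed).
`S` is bi-graded with `deg x = deg y = (1,0)`, `deg Tᵢ = (0,1)`.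
The ideal `I` is generated by the signed maximal minors of the `m × (m−1)`
Hilbert–Burch matrix `φ = [φ' φ'']` whose linear part `φ'` is the block matrix with
diagonal blocks `D_{σ₁}` (and `D_{σ₂}`, the splitting being encoded by `σ₁` alone),
where `D_a` has `x` on the main diagonal and `−y` on the subdiagonal, and whose last
column `φ''` has entries of degree `n`.
-/

/-- The variable `Tᵢ` of `S` (0-indexed); junk value `0` if `i` is out of range. -/
noncomputable def Tvar (k : Type*) [Field k] (m : ℕ) (i : ℕ) :
    MvPolynomial (Fin 2 ⊕ Fin m) k :=
  if h : i < m then X (Sum.inr ⟨i, h⟩) else 0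

/-- The Hilbert–Burch matrix `φ = [φ' φ'']`: the linear part `φ'` is the block
diagonal matrix with blocks `D_{σ₁}` and `D_{m2-σ₁}` (a single block `D_{m2}` with a
zero row when `σ₁ = m2`, i.e. `ρ = 1`), and the last column is `col = φ''`. -/
noncomputable def hbMatrix (k : Type*) [Field k] (m2 σ₁ : ℕ)
    (col : Fin (m2 + 2) → MvPolynomial (Fin 2) k) :
    Matrix (Fin (m2 + 2)) (Fin (m2 + 1)) (MvPolynomial (Fin 2) k) :=
  Matrix.of fun i j =>
    if (j : ℕ) = m2 then col i
    else if (j : ℕ) < σ₁ then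
      (if (i : ℕ) = (j : ℕ) then X 0 else if (i : ℕ) = (j : ℕ) + 1 then -(X 1) else 0)
    else
      (if (i : ℕ) = (j : ℕ) + 1 then X 0 else if (i : ℕ) = (j : ℕ) + 2 then -(X 1) else 0)

/-- The signed maximal minors `δᵢ` of the Hilbert–Burch matrix: the generators of `I`. -/
noncomputable def hbDelta (k : Type*) [Field k] (m2 σ₁ : ℕ)
    (col : Fin (m2 + 2) → MvPolynomial (Fin 2) k) (i : Fin (m2 + 2)) :
    MvPolynomial (Fin 2) k :=
  (-1) ^ (i : ℕ) * ((hbMatrix k m2 σ₁ col).submatrix i.succAbove id).det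

/-- The ideal `I ⊆ R` generated by the maximal minors of the Hilbert-Burch matrix. -/
noncomputable def hbIdeal (k : Type*) [Field k] (m2 σ₁ : ℕ)
    (col : Fin (m2 + 2) → MvPolynomial (Fin 2) k) : Ideal (MvPolynomial (Fin 2) k) :=
  Ideal.span (Set.range (hbDelta k m2 σ₁ col))

/-- The map `Π : S → R[t] = R[It]`, `x,y ↦ x,y`, `Tᵢ ↦ δᵢ t`. -/
noncomputable def PiRees (k : Type*) [Field k] (m2 σ₁ : ℕ)
    (col : Fin (m2 + 2) → MvPolynomial (Fin 2) k) :
    MvPolynomial (Fin 2 ⊕ Fin (m2 + 2)) k →ₐ[k] Polynomial (MvPolynomial (Fin 2) k) :=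
  aeval (Sum.elim (fun i => Polynomial.C (X i))
    (fun i => Polynomial.C (hbDelta k m2 σ₁ col i) * Polynomial.X))

/-- The defining ideal `𝒜 = ker Π` of the Rees algebra `𝓡(I) = R[It]`. -/
noncomputable def reesDefIdeal (k : Type*) [Field k] (m2 σ₁ : ℕ)
    (col : Fin (m2 + 2) → MvPolynomial (Fin 2) k) :
    Ideal (MvPolynomial (Fin 2 ⊕ Fin (m2 + 2)) k) :=
  RingHom.ker (PiRees k m2 σ₁ col).toRingHom

/-- Top row of the scroll matrix `ψ = [ψ₁ ⋯ ψ_ρ ψ_{ρ+1}]`, where `ψᵢ` (`i ≤ ρ`) is the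
generic scroll block on the variables `T_{i,1},…,T_{i,σᵢ+1}` and `ψ_{ρ+1} = (y,x)ᵀ`.
(The relabelling `T_{1,j} = T_j`, `T_{2,j} = T_{σ₁+1+j}` is built in; only `σ₁` and
`m2 = σ₁ + ⋯ + σ_ρ` are needed to describe `ψ`.) -/
noncomputable def psiTop (k : Type*) [Field k] (m2 σ₁ : ℕ) (j : Fin (m2 + 1)) :
    MvPolynomial (Fin 2 ⊕ Fin (m2 + 2)) k :=
  if (j : ℕ) = m2 then X (Sum.inl 1)
  else if (j : ℕ) < σ₁ then Tvar k (m2 + 2) (j : ℕ) else Tvar k (m2 + 2) ((j : ℕ) + 1)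

/-- Bottom row of the scroll matrix `ψ`. -/
noncomputable def psiBot (k : Type*) [Field k] (m2 σ₁ : ℕ) (j : Fin (m2 + 1)) :
    MvPolynomial (Fin 2 ⊕ Fin (m2 + 2)) k :=
  if (j : ℕ) = m2 then X (Sum.inl 0)
  else if (j : ℕ) < σ₁ then Tvar k (m2 + 2) ((j : ℕ) + 1) else Tvar k (m2 + 2) ((j : ℕ) + 2)

/-- `H = I₂(ψ) ⊆ S`. -/
noncomputable def scrollH (k : Type*) [Field k] (m2 σ₁ : ℕ) :
    Ideal (MvPolynomial (Fin 2 ⊕ Fin (m2 + 2)) k) :=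
  Ideal.span {p | ∃ j j' : Fin (m2 + 1),
    p = psiTop k m2 σ₁ j * psiBot k m2 σ₁ j' - psiTop k m2 σ₁ j' * psiBot k m2 σ₁ j}

/-- The height one prime ideal `K ⊆ A = S/H` generated by the entries of the top row
of `ψ`. -/
noncomputable def scrollK (k : Type*) [Field k] (m2 σ₁ : ℕ) :
    Ideal (MvPolynomial (Fin 2 ⊕ Fin (m2 + 2)) k ⧸ scrollH k m2 σ₁) :=
  Ideal.span (Set.range fun j : Fin (m2 + 1) =>
    Ideal.Quotient.mk (scrollH k m2 σ₁) (psiTop k m2 σ₁ j))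

/-- The `n`-th symbolic power of an ideal `K` of `A` (for `K` prime this is
`K^{(n)} = ⋃_{s ∉ K} (Kⁿ :_A s)`, the `K`-primary component of `Kⁿ`). -/
noncomputable def symbolicPower {A : Type*} [CommRing A] (K : Ideal A) (n : ℕ) :
    Ideal A :=
  sSup {J : Ideal A | ∃ s : A, s ∉ K ∧ J = Submodule.colon (K ^ n) (Ideal.span {s})}

/-- `g = T·φ'' = Σᵢ Tᵢ·φ''ᵢ ∈ S`. -/
noncomputable def scrollg (k : Type*) [Field k] (m2 : ℕ)
    (col : Fin (m2 + 2) → MvPolynomial (Fin 2) k) :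
    MvPolynomial (Fin 2 ⊕ Fin (m2 + 2)) k :=
  ∑ i : Fin (m2 + 2), X (Sum.inr i) * rename Sum.inl (col i)

/-- Bi-homogeneity in `S`, with `deg x = deg y = (1,0)` and `deg Tᵢ = (0,1)`. -/
def IsBiHomogeneous {k : Type*} [Field k] {m : ℕ}
    (p : MvPolynomial (Fin 2 ⊕ Fin m) k) (u s : ℕ) : Prop :=
  IsWeightedHomogeneous (Sum.elim (fun _ : Fin 2 => 1) (fun _ : Fin m => 0)) p u ∧
  IsWeightedHomogeneous (Sum.elim (fun _ : Fin 2 => 0) (fun _ : Fin m => 1)) p s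

/-- An element of `A = S/H` is bi-homogeneous of bidegree `(u,s)` if it is the image of
a bi-homogeneous element of `S` of bidegree `(u,s)`. -/
def IsBiHomogeneousQuot {k : Type*} [Field k] {m2 σ₁ : ℕ}
    (a : MvPolynomial (Fin 2 ⊕ Fin (m2 + 2)) k ⧸ scrollH k m2 σ₁) (u s : ℕ) : Prop :=
  ∃ p : MvPolynomial (Fin 2 ⊕ Fin (m2 + 2)) k,
    IsBiHomogeneous p u s ∧ Ideal.Quotient.mk (scrollH k m2 σ₁) p = a

/-- The height of an ideal: the infimum of the heights of the primes containing it. -/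
noncomputable def idealHeight {R : Type*} [CommRing R] (I : Ideal R) : ℕ∞ :=
  ⨅ (p : PrimeSpectrum R) (_ : I ≤ p.asIdeal), Order.height p

/-- The hypotheses on the numerical data: `σ₁ ≥ 1`, `n ≥ 2`, and either `ρ = 1` (a single
block `D_{σ₁}`, `σ₁ = m−2`; by convention `σ₂ = 1` in this case) or `ρ = 2`
(two blocks, `σ₁ ≥ σ₂ ≥ 1`, `σ₁ + σ₂ = m−2`). -/
def ScrollData (m2 σ₁ σ₂ ρ n : ℕ) : Prop :=
  1 ≤ σ₁ ∧ 2 ≤ n ∧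
    ((ρ = 1 ∧ σ₁ = m2 ∧ σ₂ = 1) ∨ (ρ = 2 ∧ 1 ≤ σ₂ ∧ σ₂ ≤ σ₁ ∧ σ₁ + σ₂ = m2))

/-- The context hypotheses on the ideal `I`: the entries of `φ''` are forms of degree
`n`, `I` has height two and is minimally generated by the `m` maximal minors `δᵢ`. -/
def ScrollIdealData (k : Type*) [Field k] (m2 σ₁ n : ℕ)
    (col : Fin (m2 + 2) → MvPolynomial (Fin 2) k) : Prop :=
  (∀ i, (col i).IsHomogeneous n) ∧
  idealHeight (hbIdeal k m2 σ₁ col) = 2 ∧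
  (∀ i, hbDelta k m2 σ₁ col i ∉
    Ideal.span (hbDelta k m2 σ₁ col '' {i' | i' ≠ i}))

/-- An element `v` of the graded free module `⊕ᵢ R(−t₀ i)` over `R = k[x,y]` is
homogeneous of degree `e`; i.e. each component `v i` is homogeneous of degree `e - t₀ i`. -/
def VecIsHomogeneous {k : Type*} [Field k] {p : ℕ} (t0 : Fin p → ℕ) (e : ℕ)
    (v : Fin p → MvPolynomial (Fin 2) k) : Prop :=
  ∀ i, (v i).IsHomogeneous (e - t0 i) ∧ (v i ≠ 0 → t0 i ≤ e)

/-- `HasMinimalGradedResolution I t0 t1` says that the (necessarily unique up to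
isomorphism) minimal homogeneous free resolution of the ideal `I ⊆ k[x,y]` has the form
`0 → ⊕ⱼ R(−t1 j) → ⊕ⱼ R(−t0 j) → I → 0` :
there are homogeneous generators `g j` of `I` of degrees `t0 j`, no one of which is
redundant, and a homogeneous basis `s j` (of degrees `t1 j`) of the syzygy module of `g`,
with all entries of the syzygy matrix in the maximal homogeneous ideal. -/
def HasMinimalGradedResolution {k : Type*} [Field k] {p q : ℕ}
    (I : Ideal (MvPolynomial (Fin 2) k)) (t0 : Fin p → ℕ) (t1 : Fin q → ℕ) : Prop :=
  ∃ (g : Fin p → MvPolynomial (Fin 2) k) (s : Fin q → Fin p → MvPolynomial (Fin 2) k),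
    (∀ j, (g j).IsHomogeneous (t0 j)) ∧
    Ideal.span (Set.range g) = I ∧
    (∀ j, g j ∉ Ideal.span (g '' {j' | j' ≠ j})) ∧
    (∀ j, VecIsHomogeneous t0 (t1 j) (s j)) ∧
    (∀ j i, MvPolynomial.coeff 0 (s j i) = 0) ∧
    LinearIndependent (MvPolynomial (Fin 2) k) s ∧
    (∀ v : Fin p → MvPolynomial (Fin 2) k,
      (∑ i, v i * g i = 0) ↔ v ∈ Submodule.span (MvPolynomial (Fin 2) k) (Set.range s))

/-- The Castelnuovo-Mumford regularity `max_{i,j} (t_{i,j} - i)` read off from the twists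
of a free resolution `0 → ⊕ⱼ R(−t1 j) → ⊕ⱼ R(−t0 j) → I → 0`. -/
noncomputable def regOfTwists {p q : ℕ} (t0 : Fin p → ℕ) (t1 : Fin q → ℕ) : ℤ :=
  max ((Finset.univ.sup t0 : ℕ) : ℤ) (((Finset.univ.sup t1 : ℕ) : ℤ) - 1)

/-- `I ⊆ k[x,y]` has Castelnuovo-Mumford regularity `r` (for ideals of projective
dimension at most one). -/
def HasRegularity {k : Type*} [Field k] (I : Ideal (MvPolynomial (Fin 2) k)) (r : ℤ) : Prop :=
  ∃ (p q : ℕ) (t0 : Fin p → ℕ) (t1 : Fin q → ℕ),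
    HasMinimalGradedResolution I t0 t1 ∧ regOfTwists t0 t1 = r

section Forms

variable {k : Type*} [Field k]

lemma homogeneousComponent_mul_of_isHomogeneous {σ : Type*} (c : MvPolynomial σ k)
    {b : MvPolynomial σ k} {j : ℕ} (hb : b.IsHomogeneous j) (e : ℕ) :
    homogeneousComponent e (c * b) =
      (if j ≤ e then homogeneousComponent (e - j) c else 0) * b := by
  let _ := MvPolynomial.gradedAlgebra (σ := σ) (R := k)
  have h := DirectSum.coe_decompose_mul_of_right_mem (𝒜 := homogeneousSubmodule σ k)
    (a := c) (b := b) (i := j) e ((mem_homogeneousSubmodule _ _).2 hb)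
  have h2 : ∀ (p : MvPolynomial σ k) i,
      ((DirectSum.decompose (homogeneousSubmodule σ k) p i : homogeneousSubmodule σ k i) :
        MvPolynomial σ k) = homogeneousComponent i p := fun p i =>
    decomposition.decompose'_apply p i
  rw [h2, h2] at h
  rw [h]
  split_ifs <;> simp

lemma homogeneousComponent_sum_mul_of_isHomogeneous {σ : Type*} {ι : Type*} (t : Finset ι)
    (c b : ι → MvPolynomial σ k) (j : ι → ℕ) (hb : ∀ i, (b i).IsHomogeneous (j i)) (e : ℕ) :
    homogeneousComponent e (∑ i ∈ t, c i * b i) =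
      ∑ i ∈ t, (if j i ≤ e then homogeneousComponent (e - j i) (c i) else 0) * b i := by
  rw [map_sum]
  exact Finset.sum_congr rfl fun i _ => homogeneousComponent_mul_of_isHomogeneous _ (hb i) e

/-- Every polynomial in `x, y` without constant term is `x u + y w`. -/
lemma exists_eq_X_mul_add_X_mul {p : MvPolynomial (Fin 2) k} (hp : coeff 0 p = 0) :
    ∃ u w, p = X 0 * u + X 1 * w := by
  have h : p ∈ Ideal.span (Set.range (X : Fin 2 → MvPolynomial (Fin 2) k)) := by
    rw [← Set.image_univ, mem_ideal_span_X_image]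
    intro m hm
    by_contra! h
    have : m = 0 := by ext i; simpa using h i
    subst this
    exact (mem_support_iff.1 hm) hp
  obtain ⟨c, hc⟩ := (Ideal.mem_span_range_iff_exists_fun).1 h
  exact ⟨c 0, c 1, by rw [← hc, Fin.sum_univ_two]; ring⟩

lemma exists_eq_X_mul_add_X_mul_of_isHomogeneous {p : MvPolynomial (Fin 2) k} {e : ℕ}
    (hp : p.IsHomogeneous (e + 1)) :
    ∃ u w, u.IsHomogeneous e ∧ w.IsHomogeneous e ∧ p = X 0 * u + X 1 * w := by
  obtain ⟨u, w, h⟩ := exists_eq_X_mul_add_X_mul (hp.coeff_eq_zero (d := 0) (by simp))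
  refine ⟨homogeneousComponent e u, homogeneousComponent e w,
    homogeneousComponent_isHomogeneous _ _, homogeneousComponent_isHomogeneous _ _, ?_⟩
  have h1 := homogeneousComponent_eq_self hp
  rw [h, map_add, mul_comm, homogeneousComponent_mul_of_isHomogeneous _ (isHomogeneous_X _ _),
    mul_comm (X 1), homogeneousComponent_mul_of_isHomogeneous _ (isHomogeneous_X _ _)] at h1
  simp only [Nat.le_add_left, if_true, Nat.add_sub_cancel] at h1
  linear_combination h - h1

/-- Exactness of the Koszul complex of `x, y`. -/
lemma koszul_X {a b : MvPolynomial (Fin 2) k} (h : X 0 * a + X 1 * b = 0) :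
    ∃ z, a = X 1 * z ∧ b = - (X 0 * z) := by
  have h1 : (X 1 : MvPolynomial (Fin 2) k) ∣ X 0 * a :=
    ⟨-b, by linear_combination h⟩
  rcases X_dvd_mul_iff.1 h1 with h2 | ⟨z, rfl⟩
  · rw [X_dvd_X] at h2; simp at h2
  · refine ⟨z, rfl, ?_⟩
    apply mul_left_cancel₀ (X_ne_zero (R := k) (1 : Fin 2))
    linear_combination h

lemma isHomogeneous_of_X_mul {σ : Type*} {i : σ} {p : MvPolynomial σ k} {e : ℕ}
    (h : (X i * p).IsHomogeneous (e + 1)) : p.IsHomogeneous e := by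
  rw [mul_comm] at h
  have h1 := homogeneousComponent_eq_self h
  rw [homogeneousComponent_mul_of_isHomogeneous _ (isHomogeneous_X _ _)] at h1
  simp only [Nat.le_add_left, if_true, Nat.add_sub_cancel] at h1
  rw [← mul_right_cancel₀ (X_ne_zero i) h1]
  exact homogeneousComponent_isHomogeneous _ _

lemma isHomogeneous_of_X_pow_mul {σ : Type*} {i : σ} {p : MvPolynomial σ k} {e j : ℕ}
    (h : (X i ^ j * p).IsHomogeneous (e + j)) : p.IsHomogeneous e := by
  induction j with
  | zero => simpa using h
  | succ j ih =>
    refine ih (isHomogeneous_of_X_mul (i := i) ?_)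
    rw [← mul_assoc, ← pow_succ', add_assoc]
    exact h

lemma finrank_homogeneousSubmodule_fin_two (e : ℕ) :
    Module.finrank k (homogeneousSubmodule (Fin 2) k e) = e + 1 := by
  have h : homogeneousSubmodule (Fin 2) k e = restrictSupport k {d : Fin 2 →₀ ℕ | d.degree = e} :=
    homogeneousSubmodule_eq_finsupp_supported (Fin 2) k e
  let E : {d : Fin 2 →₀ ℕ | d.degree = e} ≃ Finset.HasAntidiagonal.antidiagonal e :=
    { toFun := fun d => ⟨(d.1 0, d.1 1), by
        have := d.2
        simpa [Finsupp.degree_eq_sum] using this⟩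
      invFun := fun q => ⟨Finsupp.equivFunOnFinite.symm ![q.1.1, q.1.2], by
        have := Finset.HasAntidiagonal.mem_antidiagonal.1 q.2
        simpa [Finsupp.degree_eq_sum] using this⟩
      left_inv := fun d => by ext i; fin_cases i <;> simp
      right_inv := fun q => by simp }
  rw [h, Module.finrank_eq_nat_card_basis (basisRestrictSupport k _), Nat.card_congr E,
    Nat.card_eq_fintype_card, Fintype.card_coe, Finset.Nat.card_antidiagonal]

instance finite_homogeneousSubmodule_fin_two (e : ℕ) :
    Module.Finite k (homogeneousSubmodule (Fin 2) k e) :=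
  Module.Finite.iff_fg.2 (homogeneousSubmodule_fg (Fin 2) k e)

/-- The ideal `J` contains every form of degree `e`. -/
def ContainsForms (J : Ideal (MvPolynomial (Fin 2) k)) (e : ℕ) : Prop :=
  ∀ f : MvPolynomial (Fin 2) k, f.IsHomogeneous e → f ∈ J

lemma ContainsForms.succ {J : Ideal (MvPolynomial (Fin 2) k)} {e : ℕ} (h : ContainsForms J e) :
    ContainsForms J (e + 1) := by
  intro f hf
  obtain ⟨u, w, hu, hw, rfl⟩ := exists_eq_X_mul_add_X_mul_of_isHomogeneous hf
  exact J.add_mem (J.mul_mem_left _ (h u hu)) (J.mul_mem_left _ (h w hw))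

lemma ContainsForms.mono {J : Ideal (MvPolynomial (Fin 2) k)} {e e' : ℕ}
    (h : ContainsForms J e) (hee : e ≤ e') : ContainsForms J e' := by
  induction hee with
  | refl => exact h
  | step _ ih => exact ih.succ

/-- `(u, w) ↦ a u + b w` on forms. -/
noncomputable def pairCombination {a b : MvPolynomial (Fin 2) k} {A B U W e : ℕ}
    (ha : a.IsHomogeneous A) (hb : b.IsHomogeneous B) (hU : A + U = e) (hW : B + W = e) :
    (homogeneousSubmodule (Fin 2) k U × homogeneousSubmodule (Fin 2) k W) →ₗ[k]
      homogeneousSubmodule (Fin 2) k e where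
  toFun q := ⟨a * q.1 + b * q.2, by
    rw [mem_homogeneousSubmodule]
    refine IsHomogeneous.add ?_ ?_
    · exact hU ▸ ha.mul q.1.2
    · exact hW ▸ hb.mul q.2.2⟩
  map_add' q r := by ext1; simp; ring
  map_smul' c q := by ext1; simp

lemma containsForms_span_pair {a b : MvPolynomial (Fin 2) k} {A B : ℕ}
    (ha : a.IsHomogeneous (A + 2)) (hb : b.IsHomogeneous (B + 2)) (hab : IsRelPrime a b) :
    ContainsForms (Ideal.span {a, b}) (A + B + 3) := by
  have hb0 : b ≠ 0 := by
    rintro rfl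
    have h1 : IsUnit a := isRelPrime_zero_right.1 hab
    obtain ⟨r, -, rfl⟩ := MvPolynomial.isUnit_iff_eq_C_of_isReduced.1 h1
    have := (isHomogeneous_C (Fin 2) r).inj_right ha h1.ne_zero
    omega
  let L := pairCombination ha hb (show A + 2 + (B + 1) = A + B + 3 by ring)
    (show B + 2 + (A + 1) = A + B + 3 by ring)
  have hinj : Function.Injective L := by
    rw [injective_iff_map_eq_zero]
    rintro ⟨⟨u, hu⟩, ⟨w, hw⟩⟩ h
    have h' : a * u + b * w = 0 := congrArg Subtype.val h
    have hdvd : b ∣ u := hab.symm.dvd_of_dvd_mul_left ⟨-w, by linear_combination h'⟩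
    have hu0 : u = 0 := by
      by_contra hu0
      obtain ⟨c, rfl⟩ := hdvd
      have h1 := totalDegree_mul_of_isDomain (f := b) (g := c) hb0 (right_ne_zero_of_mul hu0)
      rw [IsHomogeneous.totalDegree hu hu0, hb.totalDegree hb0] at h1
      omega
    subst hu0
    have hw0 : w = 0 := by simpa [hb0] using h'
    subst hw0
    rfl
  have hsurj : Function.Surjective L := by
    refine (LinearMap.injective_iff_surjective_of_finrank_eq_finrank ?_).1 hinj
    simp only [Module.finrank_prod, finrank_homogeneousSubmodule_fin_two]
    ring
  intro f hf
  obtain ⟨⟨u, w⟩, h⟩ := hsurj ⟨f, hf⟩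
  have h' : a * u + b * w = f := congrArg Subtype.val h
  rw [Ideal.mem_span_pair]
  exact ⟨u, w, by linear_combination h'⟩

lemma not_containsForms_span_pair {a b : MvPolynomial (Fin 2) k} {A B : ℕ}
    (ha : a.IsHomogeneous (A + 2)) (hb : b.IsHomogeneous (B + 2)) :
    ¬ ContainsForms (Ideal.span {a, b}) (A + B + 2) := by
  intro hc
  let L := pairCombination ha hb (show A + 2 + B = A + B + 2 by ring)
    (show B + 2 + A = A + B + 2 by ring)
  have hsurj : Function.Surjective L := by
    rintro ⟨f, hf⟩
    obtain ⟨u, w, h⟩ := Ideal.mem_span_pair.1 (hc f hf)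
    refine ⟨⟨⟨_, homogeneousComponent_mem B u⟩, ⟨_, homogeneousComponent_mem A w⟩⟩, ?_⟩
    apply Subtype.ext
    change a * homogeneousComponent B u + b * homogeneousComponent A w = f
    have h1 := homogeneousComponent_eq_self (show f.IsHomogeneous (A + B + 2) from hf)
    rw [← h, map_add, homogeneousComponent_mul_of_isHomogeneous _ ha,
      homogeneousComponent_mul_of_isHomogeneous _ hb, h, if_pos (by omega), if_pos (by omega),
      show A + B + 2 - (A + 2) = B by omega, show A + B + 2 - (B + 2) = A by omega] at h1
    linear_combination h1
  have := LinearMap.finrank_le_finrank_of_surjective hsurj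
  simp only [Module.finrank_prod, finrank_homogeneousSubmodule_fin_two] at this
  omega

lemma containsForms_span_pair_pow {a b : MvPolynomial (Fin 2) k} {A B : ℕ} (hAB : A ≤ B)
    (ha : a.IsHomogeneous (A + 2)) (hb : b.IsHomogeneous (B + 2)) (hab : IsRelPrime a b) (s : ℕ) :
    ContainsForms (Ideal.span {a, b} ^ (s + 1)) (A + 1 + (s + 1) * (B + 2)) := by
  induction s with
  | zero =>
    simpa [show A + 1 + (B + 2) = A + B + 3 by ring] using containsForms_span_pair ha hb hab
  | succ s ih =>
    intro f hf
    have h1 := (containsForms_span_pair ha hb hab).mono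
      (show A + B + 3 ≤ A + 1 + (s + 1 + 1) * (B + 2) by nlinarith [Nat.zero_le (s * (B + 2))]) f hf
    obtain ⟨u, w, h⟩ := Ideal.mem_span_pair.1 h1
    have h2 := homogeneousComponent_eq_self hf
    rw [← h, map_add, homogeneousComponent_mul_of_isHomogeneous _ ha,
      homogeneousComponent_mul_of_isHomogeneous _ hb, h,
      if_pos (by nlinarith [Nat.zero_le (s * (B + 2))]),
      if_pos (by nlinarith [Nat.zero_le (s * (B + 2))])] at h2
    rw [← h2, pow_succ]
    refine Ideal.add_mem _ (Ideal.mul_mem_mul ?_ (Ideal.subset_span (by simp)))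
      (Ideal.mul_mem_mul ?_ (Ideal.subset_span (by simp)))
    · refine ih.mono ?_ _ (homogeneousComponent_isHomogeneous _ _)
      apply Nat.le_sub_of_add_le
      nlinarith
    · refine ih.mono ?_ _ (homogeneousComponent_isHomogeneous _ _)
      apply Nat.le_sub_of_add_le
      nlinarith

lemma sup_pow_le_sup_pow_right {R : Type*} [CommRing R] (I J : Ideal R) (s : ℕ) :
    (I ⊔ J) ^ s ≤ I ⊔ J ^ s := by
  induction s with
  | zero => simp
  | succ s ih =>
    rw [pow_succ, pow_succ]
    refine (Ideal.mul_mono_left ih).trans ?_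
    rw [Ideal.sup_mul, Ideal.mul_sup (J ^ s)]
    have h1 : I * (I ⊔ J) ≤ I := Ideal.mul_le_left
    have h2 : J ^ s * I ≤ I := Ideal.mul_le_right
    exact sup_le (h1.trans le_sup_left) (sup_le (h2.trans le_sup_left) le_sup_right)

lemma mem_span_pair_of_pow_mul_mem {a b h : MvPolynomial (Fin 2) k} (hab : IsRelPrime a b)
    (s : ℕ) (hs : b ^ s * h ∈ Ideal.span {a, b} ^ (s + 1)) : h ∈ Ideal.span {a, b} := by
  have h1 : Ideal.span {a, b} ^ (s + 1) ≤ Ideal.span {a, b ^ (s + 1)} := by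
    rw [Ideal.span_insert, Ideal.span_insert, ← Ideal.span_singleton_pow]
    exact sup_pow_le_sup_pow_right _ _ _
  obtain ⟨u, w, huw⟩ := Ideal.mem_span_pair.1 (h1 hs)
  have h2 : a ∣ b ^ s * (h - w * b) := ⟨u, by linear_combination -huw⟩
  obtain ⟨c, hc⟩ := (IsRelPrime.pow_right hab).dvd_of_dvd_mul_left h2
  exact Ideal.mem_span_pair.2 ⟨c, w, by linear_combination -hc⟩

lemma not_containsForms_span_pair_pow {a b : MvPolynomial (Fin 2) k} {A B : ℕ}
    (ha : a.IsHomogeneous (A + 2)) (hb : b.IsHomogeneous (B + 2)) (hab : IsRelPrime a b) (s : ℕ) :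
    ¬ ContainsForms (Ideal.span {a, b} ^ (s + 1)) (A + (s + 1) * (B + 2)) := by
  intro h
  refine not_containsForms_span_pair ha hb fun f hf => ?_
  refine mem_span_pair_of_pow_mul_mem hab s (h _ ?_)
  convert (hb.pow s).mul hf using 1
  ring

end Forms

section Resolutions

lemma exists_nonredundant_family {R M : Type*} [Ring R] [AddCommGroup M] [Module R M]
    (T : Set M) (hfg : (Submodule.span R T).FG) :
    ∃ (q : ℕ) (s : Fin q → M), (∀ j, s j ∈ T) ∧
      Submodule.span R (Set.range s) = Submodule.span R T ∧
      ∀ j, s j ∉ Submodule.span R (s '' {j' | j' ≠ j}) := by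
  classical
  have hex : ∃ (q : ℕ) (s : Fin q → M), (∀ j, s j ∈ T) ∧
      Submodule.span R (Set.range s) = Submodule.span R T := by
    obtain ⟨t, htT, ht⟩ := (Submodule.fg_span_iff_fg_span_finset_subset T).1 hfg
    refine ⟨t.card, fun j => (t.equivFin.symm j : M), fun j => htT (t.equivFin.symm j).2, ?_⟩
    rw [ht]
    congr 1
    ext m
    constructor
    · rintro ⟨j, rfl⟩
      exact (t.equivFin.symm j).2
    · intro hm
      exact ⟨t.equivFin ⟨m, hm⟩, by simp⟩
  obtain ⟨s, hsT, hs⟩ := Nat.find_spec hex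
  refine ⟨Nat.find hex, s, hsT, hs, fun j hj => ?_⟩
  obtain ⟨q, hq⟩ : ∃ q, Nat.find hex = q + 1 :=
    Nat.exists_eq_succ_of_ne_zero (by have := j.2; omega)
  refine Nat.find_min hex (m := q) (by omega) ?_
  generalize Nat.find hex = N at *
  subst hq
  refine ⟨fun l => s (j.succAbove l), fun l => hsT _, ?_⟩
  rw [← hs]
  have himg : s '' {j' | j' ≠ j} = Set.range fun l => s (j.succAbove l) := by
    change _ = Set.range (s ∘ j.succAbove)
    rw [Set.range_comp, Fin.range_succAbove]
    rfl
  rw [himg] at hj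
  refine le_antisymm (Submodule.span_mono ?_) (Submodule.span_le.2 ?_)
  · rintro _ ⟨l, rfl⟩
    exact ⟨_, rfl⟩
  · rintro _ ⟨l, rfl⟩
    rcases eq_or_ne l j with rfl | hl
    · exact hj
    · obtain ⟨l', rfl⟩ := Fin.exists_succAbove_eq hl
      exact Submodule.subset_span ⟨l', rfl⟩

variable {k : Type*} [Field k]

lemma eq_zero_of_nonredundant {M : Type*} {σ : Type*} [AddCommGroup M] [Module (MvPolynomial σ k) M]
    {q : ℕ} {s : Fin q → M} {j : Fin q}
    (hs : s j ∉ Submodule.span (MvPolynomial σ k) (s '' {j' | j' ≠ j}))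
    {c : Fin q → MvPolynomial σ k} (hc : ∑ l, c l • s l = 0) {r : k} (hr : c j = C r) : r = 0 := by
  by_contra hr0
  refine hs ?_
  have h1 : s j = - (C r⁻¹ : MvPolynomial σ k) • ∑ l ∈ Finset.univ.erase j, c l • s l := by
    rw [← Finset.add_sum_erase _ _ (Finset.mem_univ j), hr] at hc
    rw [neg_smul, ← smul_neg, ← eq_neg_of_add_eq_zero_left hc, smul_smul, ← C_mul,
      inv_mul_cancel₀ hr0, C_1, one_smul]
  rw [h1]
  refine Submodule.smul_mem _ _ (Submodule.sum_mem _ fun l hl => Submodule.smul_mem _ _ ?_)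
  exact Submodule.subset_span ⟨l, Finset.ne_of_mem_erase hl, rfl⟩

lemma exists_relation_eq_C {σ ι : Type*} {q : ℕ} (s : Fin q → ι → MvPolynomial σ k) (e : Fin q → ℕ)
    (hs : ∀ j i, (s j i).IsHomogeneous (e j)) (c : Fin q → MvPolynomial σ k)
    (hc : ∀ i, ∑ j, c j * s j i = 0) (j₀ : Fin q) :
    ∃ c' : Fin q → MvPolynomial σ k, c' j₀ = C (coeff 0 (c j₀)) ∧
      ∀ i, ∑ j, c' j * s j i = 0 := by
  refine ⟨fun j => if e j ≤ e j₀ then homogeneousComponent (e j₀ - e j) (c j) else 0, ?_, ?_⟩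
  · simp
  · intro i
    have h := homogeneousComponent_sum_mul_of_isHomogeneous Finset.univ c (fun j => s j i) e
      (fun j => hs j i) (e j₀)
    rw [hc, map_zero] at h
    exact h.symm

/-- The syzygy module of `g`. -/
noncomputable def syzygies {p : ℕ} (g : Fin p → MvPolynomial (Fin 2) k) :
    Submodule (MvPolynomial (Fin 2) k) (Fin p → MvPolynomial (Fin 2) k) :=
  LinearMap.ker (Fintype.linearCombination (MvPolynomial (Fin 2) k) g)

lemma mem_syzygies {p : ℕ} {g : Fin p → MvPolynomial (Fin 2) k}
    {v : Fin p → MvPolynomial (Fin 2) k} : v ∈ syzygies g ↔ ∑ i, v i * g i = 0 := by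
  simp [syzygies, Fintype.linearCombination_apply]

lemma span_homogeneous_syzygies {p : ℕ} {g : Fin p → MvPolynomial (Fin 2) k} {D : ℕ}
    (hg : ∀ i, (g i).IsHomogeneous D) :
    Submodule.span _ {v | v ∈ syzygies g ∧ ∃ e, ∀ i, (v i).IsHomogeneous e} = syzygies g := by
  refine le_antisymm (Submodule.span_le.2 fun v hv => hv.1) fun v hv => ?_
  have hsum : v = ∑ e ∈ Finset.range (Finset.univ.sup (fun i => (v i).totalDegree) + 1),
      fun i => homogeneousComponent e (v i) := by
    ext1 i
    rw [Finset.sum_apply]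
    conv_lhs => rw [← sum_homogeneousComponent (v i)]
    refine Finset.sum_subset (Finset.range_subset_range.2 ?_) fun e _ he => ?_
    · have := Finset.le_sup (f := fun i => (v i).totalDegree) (Finset.mem_univ i)
      simpa using this
    · exact homogeneousComponent_eq_zero _ _ (by simpa using he)
  rw [hsum]
  refine Submodule.sum_mem _ fun e _ => Submodule.subset_span
    ⟨mem_syzygies.2 ?_, e, fun i => homogeneousComponent_isHomogeneous _ _⟩
  have h := homogeneousComponent_sum_mul_of_isHomogeneous Finset.univ v g (fun _ => D) hg (e + D)
  rw [mem_syzygies.1 hv] at h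
  simpa using h.symm

lemma koszul_X_vec {ι : Type*} {u w : ι → MvPolynomial (Fin 2) k}
    (h : ∀ i, X 0 * u i + X 1 * w i = 0) :
    ∃ z : ι → MvPolynomial (Fin 2) k, (∀ i, u i = X 1 * z i) ∧ ∀ i, w i = - (X 0 * z i) := by
  choose z hz using fun i => koszul_X (h i)
  exact ⟨z, fun i => (hz i).1, fun i => (hz i).2⟩

/-- If every relation has all its coefficients without constant term and the module of relations
satisfies the Koszul descent, then it is zero. -/
lemma linearIndependent_syzygies {p q : ℕ} {g : Fin p → MvPolynomial (Fin 2) k}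
    {s : Fin q → Fin p → MvPolynomial (Fin 2) k}
    (hspan : Submodule.span (MvPolynomial (Fin 2) k) (Set.range s) = syzygies g)
    (h0 : ∀ c : Fin q → MvPolynomial (Fin 2) k, ∑ j, c j • s j = 0 → ∀ j, coeff 0 (c j) = 0) :
    LinearIndependent (MvPolynomial (Fin 2) k) s := by
  have key : ∀ N : ℕ, ∀ c : Fin q → MvPolynomial (Fin 2) k, ∑ j, c j • s j = 0 →
      ∀ j, ∀ m : Fin 2 →₀ ℕ, m.degree < N → coeff m (c j) = 0 := by
    intro N
    induction N with
    | zero => intro c hc j m hm; omega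
    | succ N ih =>
      intro c hc
      choose u w huw using fun j => exists_eq_X_mul_add_X_mul (h0 c hc j)
      have hsyz : ∀ c : Fin q → MvPolynomial (Fin 2) k, ∑ j, c j • s j ∈ syzygies g := fun c =>
        hspan ▸ Submodule.sum_mem _ fun j _ => Submodule.smul_mem _ _
          (Submodule.subset_span ⟨j, rfl⟩)
      have hrel : (X 0 : MvPolynomial (Fin 2) k) • ∑ j, u j • s j +
          (X 1 : MvPolynomial (Fin 2) k) • ∑ j, w j • s j = 0 := by
        rw [← hc, Finset.smul_sum, Finset.smul_sum, ← Finset.sum_add_distrib]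
        refine Finset.sum_congr rfl fun j _ => ?_
        rw [huw, add_smul, smul_smul, smul_smul]
      obtain ⟨z, hz1, hz2⟩ := koszul_X_vec fun i => congrFun hrel i
      have hz : z ∈ syzygies g := by
        rw [mem_syzygies]
        have h1 := mem_syzygies.1 (hsyz u)
        simp_rw [hz1, mul_assoc] at h1
        rw [← Finset.mul_sum] at h1
        exact (mul_eq_zero.1 h1).resolve_left (X_ne_zero _)
      rw [← hspan, Submodule.mem_span_range_iff_exists_fun] at hz
      obtain ⟨b, hb⟩ := hz
      have hu : ∑ j, (u j - X 1 * b j) • s j = 0 := by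
        simp_rw [sub_smul, Finset.sum_sub_distrib, ← smul_smul]
        rw [← Finset.smul_sum, hb]
        ext1 i
        simp [hz1 i]
      have hw : ∑ j, (w j + X 0 * b j) • s j = 0 := by
        simp_rw [add_smul, Finset.sum_add_distrib, ← smul_smul]
        rw [← Finset.smul_sum, hb]
        ext1 i
        simp [hz2 i]
      intro j m hm
      have hcj : c j = X 0 * (u j - X 1 * b j) + X 1 * (w j + X 0 * b j) := by
        rw [huw]; ring
      have hcoeff : ∀ (i : Fin 2) (f : MvPolynomial (Fin 2) k),
          (∀ m : Fin 2 →₀ ℕ, m.degree < N → coeff m f = 0) → coeff m (X i * f) = 0 := by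
        intro i f hf
        rw [coeff_X_mul']
        split_ifs with hi
        · refine hf _ ?_
          have h1 : Finsupp.single i 1 ≤ m := by
            rw [Finsupp.single_le_iff]
            exact Nat.one_le_iff_ne_zero.2 (Finsupp.mem_support_iff.1 hi)
          have h2 := congrArg Finsupp.degree (tsub_add_cancel_of_le h1)
          rw [map_add, Finsupp.degree_single] at h2
          omega
        · rfl
      rw [hcj, coeff_add, hcoeff 0 _ (ih _ hu j), hcoeff 1 _ (ih _ hw j), add_zero]
  rw [Fintype.linearIndependent_iff]
  intro c hc j
  ext m
  rw [coeff_zero]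
  exact key (m.degree + 1) c hc j m (Nat.lt_succ_self _)

theorem exists_minimal_resolution (J : Ideal (MvPolynomial (Fin 2) k)) (D : ℕ)
    (hJ : Ideal.span {f | f ∈ J ∧ f.IsHomogeneous D} = J) :
    ∃ (p q : ℕ) (t1 : Fin q → ℕ), HasMinimalGradedResolution J (fun _ : Fin p => D) t1 := by
  obtain ⟨p, g, hgT, hgspan, hgred⟩ := exists_nonredundant_family
    (R := MvPolynomial (Fin 2) k) {f | f ∈ J ∧ f.IsHomogeneous D} (IsNoetherian.noetherian _)
  obtain ⟨q, s, hsT, hsspan, hsred⟩ := exists_nonredundant_family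
    (R := MvPolynomial (Fin 2) k) {v | v ∈ syzygies g ∧ ∃ e, ∀ i, (v i).IsHomogeneous e}
    (IsNoetherian.noetherian _)
  rw [span_homogeneous_syzygies fun i => (hgT i).2] at hsspan
  choose e he using fun j => (hsT j).2
  refine ⟨p, q, fun j => D + e j, g, s, fun j => (hgT j).2, hgspan.trans hJ, hgred, ?_, ?_, ?_, ?_⟩
  · intro j i
    exact ⟨by simpa using he j i, fun _ => Nat.le_add_right _ _⟩
  · intro j i
    obtain ⟨c', hc', hrel⟩ := exists_relation_eq_C (fun l (_ : Unit) => g l) (fun _ => D)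
      (fun l _ => (hgT l).2) (s j) (fun _ => mem_syzygies.1 (hsT j).1) i
    exact eq_zero_of_nonredundant (hgred i) (hrel ()) hc'
  · refine linearIndependent_syzygies hsspan fun c hc j => ?_
    obtain ⟨c', hc', hrel⟩ := exists_relation_eq_C s e he c
      (fun i => by simpa using congrFun hc i) j
    exact eq_zero_of_nonredundant (hsred j) (by ext1 i; simpa using hrel i) hc'
  · intro v
    rw [hsspan, mem_syzygies]

lemma containsForms_of_twists_le {J : Ideal (MvPolynomial (Fin 2) k)} {p q D r : ℕ}
    {t1 : Fin q → ℕ} (h : HasMinimalGradedResolution J (fun _ : Fin p => D) t1) (hDr : D ≤ r)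
    (ht : ∀ j, t1 j ≤ r + 1) {N : ℕ} (hN : ContainsForms J N) : ContainsForms J r := by
  obtain ⟨g, s, hg, rfl, -, hs, -, -, hsyz⟩ := h
  have step : ∀ e, r ≤ e → ContainsForms (Ideal.span (Set.range g)) (e + 1) →
      ContainsForms (Ideal.span (Set.range g)) e := by
    intro e hre hc f hf
    have aux : ∀ i : Fin 2, ∃ u : Fin p → MvPolynomial (Fin 2) k,
        (∀ l, (u l).IsHomogeneous (e + 1 - D)) ∧ ∑ l, u l * g l = X i * f := by
      intro i
      have hXf : (X i * f).IsHomogeneous (e + 1) := by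
        rw [add_comm]; exact (isHomogeneous_X _ _).mul hf
      obtain ⟨c, hc⟩ := Ideal.mem_span_range_iff_exists_fun.1 (hc _ hXf)
      refine ⟨fun l => homogeneousComponent (e + 1 - D) (c l),
        fun l => homogeneousComponent_isHomogeneous _ _, ?_⟩
      have h1 := homogeneousComponent_sum_mul_of_isHomogeneous Finset.univ c g (fun _ => D) hg
        (e + 1)
      rw [hc, homogeneousComponent_eq_self hXf] at h1
      rw [h1]
      simp [show D ≤ e + 1 by omega]
    obtain ⟨u, hu, huf⟩ := aux 0
    obtain ⟨w, hw, hwf⟩ := aux 1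
    have hv : ∑ l, (X 1 * u l - X 0 * w l) * g l = 0 := by
      simp_rw [sub_mul, Finset.sum_sub_distrib, mul_assoc, ← Finset.mul_sum]
      rw [huf, hwf]; ring
    have hvhom : ∀ l, (X 1 * u l - X 0 * w l).IsHomogeneous (e + 2 - D) := by
      intro l
      have h1 : e + 2 - D = 1 + (e + 1 - D) := by omega
      rw [h1]
      exact ((isHomogeneous_X _ _).mul (hu l)).sub ((isHomogeneous_X _ _).mul (hw l))
    obtain ⟨c, hc⟩ := (Submodule.mem_span_range_iff_exists_fun _).1
      ((hsyz fun l => X 1 * u l - X 0 * w l).1 hv)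
    have hc' : ∀ l, X 1 * u l - X 0 * w l =
        ∑ j, homogeneousComponent (e + 2 - D - (t1 j - D)) (c j) * s j l := by
      intro l
      have h1 := homogeneousComponent_sum_mul_of_isHomogeneous Finset.univ c (fun j => s j l)
        (fun j => t1 j - D) (fun j => (hs j l).1) (e + 2 - D)
      have h2 : ∑ j, c j * s j l = X 1 * u l - X 0 * w l := by simpa using congrFun hc l
      rw [h2, homogeneousComponent_eq_self (hvhom l)] at h1
      rw [h1]
      refine Finset.sum_congr rfl fun j _ => ?_
      rw [if_pos]
      have := ht j
      omega
    choose a b hab using fun j => exists_eq_X_mul_add_X_mul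
      (p := homogeneousComponent (e + 2 - D - (t1 j - D)) (c j)) (by
        have := ht j
        rw [coeff_homogeneousComponent, if_neg]
        simp only [map_zero]
        omega)
    obtain ⟨z, -, hz⟩ := koszul_X_vec (u := fun l => w l + ∑ j, a j * s j l)
      (w := fun l => -(u l - ∑ j, b j * s j l)) (by
        intro l
        have h1 := hc' l
        simp_rw [hab, add_mul, Finset.sum_add_distrib, mul_assoc, ← Finset.mul_sum] at h1
        linear_combination -h1)
    have hs0 : ∀ j, ∑ l, s j l * g l = 0 := fun j =>
      (hsyz (s j)).2 (Submodule.subset_span ⟨j, rfl⟩)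
    have hfin : X 0 * f = X 0 * ∑ l, z l * g l := by
      have h1 : ∀ l, u l * g l = X 0 * (z l * g l) + ∑ j, b j * (s j l * g l) := by
        intro l
        have h2 := hz l
        have h3 : ∑ j, b j * (s j l * g l) = (∑ j, b j * s j l) * g l := by
          rw [Finset.sum_mul]; exact Finset.sum_congr rfl fun j _ => by ring
        rw [h3]
        linear_combination (-g l) * h2
      rw [← huf]
      simp_rw [h1, Finset.sum_add_distrib, ← Finset.mul_sum]
      rw [Finset.sum_comm]
      simp_rw [← Finset.mul_sum, hs0]
      simp
    rw [mul_left_cancel₀ (X_ne_zero _) hfin]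
    exact Ideal.mem_span_range_iff_exists_fun.2 ⟨z, rfl⟩
  have hbig : ContainsForms (Ideal.span (Set.range g)) (r + N) := hN.mono (Nat.le_add_left _ _)
  clear hN
  induction N with
  | zero => exact hbig
  | succ N ih => exact ih (step _ (Nat.le_add_right _ _) hbig)

lemma twists_le_of_containsForms {J : Ideal (MvPolynomial (Fin 2) k)} {p q D r : ℕ}
    {t1 : Fin q → ℕ} (h : HasMinimalGradedResolution J (fun _ : Fin p => D) t1) (hDr : D ≤ r)
    (hr : ContainsForms J r) (j : Fin q) : t1 j ≤ r + 1 := by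
  obtain ⟨g, s, hg, rfl, -, hs, -, hli, hsyz⟩ := h
  by_contra! ht
  obtain ⟨e, he⟩ : ∃ e, t1 j - D = e + 1 := ⟨t1 j - D - 1, by omega⟩
  choose u w hu hw huw using fun l => exists_eq_X_mul_add_X_mul_of_isHomogeneous
    (show (s j l).IsHomogeneous (e + 1) from he ▸ (hs j l).1)
  have hsj : ∑ l, s j l * g l = 0 := (hsyz (s j)).2 (Submodule.subset_span ⟨j, rfl⟩)
  simp_rw [huw, add_mul, Finset.sum_add_distrib, mul_assoc, ← Finset.mul_sum] at hsj
  obtain ⟨f, hf1, hf2⟩ := koszul_X hsj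
  have hf : f.IsHomogeneous (e + D - 1) := by
    refine isHomogeneous_of_X_mul (i := 1) ?_
    rw [← hf1, show e + D - 1 + 1 = e + D by omega]
    exact IsHomogeneous.sum _ _ _ fun l _ => (hu l).mul (hg l)
  obtain ⟨z, hz⟩ := Ideal.mem_span_range_iff_exists_fun.1 (hr.mono (by omega) f hf)
  have h1 : (fun l => u l - X 1 * z l) ∈ Submodule.span (MvPolynomial (Fin 2) k) (Set.range s) := by
    rw [← hsyz]
    simp_rw [sub_mul, Finset.sum_sub_distrib, mul_assoc, ← Finset.mul_sum]
    rw [hf1, hz, sub_self]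
  have h2 : (fun l => w l + X 0 * z l) ∈ Submodule.span (MvPolynomial (Fin 2) k) (Set.range s) := by
    rw [← hsyz]
    simp_rw [add_mul, Finset.sum_add_distrib, mul_assoc, ← Finset.mul_sum]
    rw [hf2, hz, neg_add_cancel]
  obtain ⟨a, ha⟩ := (Submodule.mem_span_range_iff_exists_fun _).1 h1
  obtain ⟨b, hb⟩ := (Submodule.mem_span_range_iff_exists_fun _).1 h2
  have hrel : ∑ l, (X 0 * a l + X 1 * b l - if l = j then 1 else 0) • s l = 0 := by
    simp_rw [sub_smul, add_smul, Finset.sum_sub_distrib, Finset.sum_add_distrib, ← smul_smul,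
      ← Finset.smul_sum]
    rw [ha, hb]
    ext1 l
    simp [huw]
    ring
  have h3 := congrArg (coeff 0) (Fintype.linearIndependent_iff.1 hli _ hrel j)
  simp [coeff_X_mul'] at h3

end Resolutions

section HilbertBurch

open scoped Pointwise

variable {k : Type*} [Field k]

lemma exists_eq_of_mul_chain (f : ℕ → MvPolynomial (Fin 2) k) (N : ℕ)
    (h : ∀ i < N, X 0 * f i = X 1 * f (i + 1)) :
    ∃ a, ∀ i ≤ N, f i = X 0 ^ i * X 1 ^ (N - i) * a := by
  induction N with
  | zero => exact ⟨f 0, fun i hi => by simp [Nat.le_zero.1 hi]⟩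
  | succ N ih =>
    obtain ⟨a, ha⟩ := ih fun i hi => h i (by omega)
    have h1 := h N (by omega)
    have h2 : X 0 * (X 0 ^ N * a) + X 1 * (-f (N + 1)) = 0 := by
      have := ha N le_rfl
      simp only [Nat.sub_self, pow_zero, mul_one] at this
      rw [← this]
      linear_combination h1
    obtain ⟨z, hz, hz'⟩ := koszul_X h2
    have h3 : (X 1 : MvPolynomial (Fin 2) k) ∣ a := by
      have h4 : (X 1 : MvPolynomial (Fin 2) k) ∣ X 0 ^ N * a := ⟨z, hz⟩
      refine ((X_prime (R := k) (i := (1 : Fin 2))).dvd_or_dvd h4).resolve_left fun h5 => ?_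
      have h6 := (X_prime (R := k) (i := (1 : Fin 2))).dvd_of_dvd_pow h5
      rw [X_dvd_X] at h6
      simp at h6
    obtain ⟨a', rfl⟩ := h3
    refine ⟨a', fun i hi => ?_⟩
    rcases Nat.lt_or_ge i (N + 1) with hi' | hi'
    · rw [ha i (by omega), show N + 1 - i = N - i + 1 by omega]
      ring
    · obtain rfl : i = N + 1 := by omega
      have h4 : z = X 0 ^ N * a' := by
        apply mul_left_cancel₀ (X_ne_zero (R := k) (1 : Fin 2))
        linear_combination -hz
      rw [h4] at hz'
      simp only [Nat.sub_self, pow_zero, mul_one]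
      linear_combination -hz'

lemma sum_hbDelta_mul_hbMatrix (m2 σ₁ : ℕ) (col : Fin (m2 + 2) → MvPolynomial (Fin 2) k)
    (j : Fin (m2 + 1)) :
    ∑ i, hbDelta k m2 σ₁ col i * hbMatrix k m2 σ₁ col i j = 0 := by
  let N : Matrix (Fin (m2 + 2)) (Fin (m2 + 2)) (MvPolynomial (Fin 2) k) :=
    Matrix.of fun i => Fin.cons (hbMatrix k m2 σ₁ col i j) (hbMatrix k m2 σ₁ col i)
  have h : N.det = 0 :=
    Matrix.det_zero_of_column_eq (Fin.succ_ne_zero j).symm fun i => by simp [N]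
  rw [Matrix.det_succ_column_zero] at h
  rw [← h]
  refine Finset.sum_congr rfl fun i _ => ?_
  have h1 : N.submatrix i.succAbove Fin.succ =
      (hbMatrix k m2 σ₁ col).submatrix i.succAbove id := by
    ext a b; simp [N]
  rw [h1, hbDelta]
  simp only [N, Matrix.of_apply, Fin.cons_zero]
  ring

lemma sum_mul_ite_ite {R : Type*} [CommRing R] {N : ℕ} (f : Fin N → R) {a b : ℕ} (ha : a < N)
    (hb : b < N) (hab : a ≠ b) (P Q : R) :
    ∑ i, f i * (if (i : ℕ) = a then P else if (i : ℕ) = b then Q else 0) =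
      f ⟨a, ha⟩ * P + f ⟨b, hb⟩ * Q := by
  have h : ∀ i : Fin N, f i * (if (i : ℕ) = a then P else if (i : ℕ) = b then Q else 0) =
      (if i = ⟨a, ha⟩ then f i * P else 0) + (if i = ⟨b, hb⟩ then f i * Q else 0) := by
    intro i
    simp only [Fin.ext_iff]
    split_ifs <;> first | omega | simp
  simp_rw [h, Finset.sum_add_distrib]
  simp

lemma isHomogeneous_hbDelta {m2 σ₁ n : ℕ} {col : Fin (m2 + 2) → MvPolynomial (Fin 2) k}
    (hcol : ∀ i, (col i).IsHomogeneous n) (i : Fin (m2 + 2)) :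
    (hbDelta k m2 σ₁ col i).IsHomogeneous (n + m2) := by
  have hsum : ∑ j : Fin (m2 + 1), (if (j : ℕ) = m2 then n else 1) = n + m2 := by
    rw [Fin.sum_univ_castSucc]
    have : ∀ j : Fin m2, (j : ℕ) ≠ m2 := fun j => j.2.ne
    simp [this, add_comm]
  have hent : ∀ i j, (hbMatrix k m2 σ₁ col i j).IsHomogeneous (if (j : ℕ) = m2 then n else 1) := by
    intro i j
    simp only [hbMatrix, Matrix.of_apply]
    split_ifs <;> first
      | exact hcol i
      | exact isHomogeneous_X _ _
      | exact (isHomogeneous_X _ _).neg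
      | exact isHomogeneous_zero _ _ _
  have hdet : ((hbMatrix k m2 σ₁ col).submatrix i.succAbove id).det.IsHomogeneous (n + m2) := by
    rw [Matrix.det_apply']
    refine IsHomogeneous.sum _ _ _ fun τ _ => ?_
    rw [← zero_add (n + m2), ← hsum]
    refine IsHomogeneous.mul ?_ (IsHomogeneous.prod _ _ _ fun j _ => hent _ _)
    rw [← map_intCast (C : k →+* MvPolynomial (Fin 2) k)]
    exact isHomogeneous_C _ _
  rw [hbDelta, ← zero_add (n + m2)]
  refine IsHomogeneous.mul ?_ hdet
  have : ((-1) ^ (i : ℕ) : MvPolynomial (Fin 2) k) = C ((-1) ^ (i : ℕ)) := by simp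
  rw [this]
  exact isHomogeneous_C _ _

lemma exists_hbDelta_eq {m2 σ₁ : ℕ} (hσ : σ₁ ≤ m2) (col : Fin (m2 + 2) → MvPolynomial (Fin 2) k) :
    ∃ a b : MvPolynomial (Fin 2) k,
      (∀ i (hi : i < m2 + 2), i ≤ σ₁ →
        hbDelta k m2 σ₁ col ⟨i, hi⟩ = X 0 ^ i * X 1 ^ (σ₁ - i) * a) ∧
      (∀ i (hi : σ₁ + 1 + i < m2 + 2),
        hbDelta k m2 σ₁ col ⟨σ₁ + 1 + i, hi⟩ = X 0 ^ i * X 1 ^ (m2 - σ₁ - i) * b) := by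
  let F : ℕ → MvPolynomial (Fin 2) k := fun i =>
    if h : i < m2 + 2 then hbDelta k m2 σ₁ col ⟨i, h⟩ else 0
  have hF : ∀ i (hi : i < m2 + 2), F i = hbDelta k m2 σ₁ col ⟨i, hi⟩ := fun i hi => dif_pos hi
  obtain ⟨a, ha⟩ := exists_eq_of_mul_chain F σ₁ fun i hi => by
    have h := sum_hbDelta_mul_hbMatrix m2 σ₁ col ⟨i, by omega⟩
    simp only [hbMatrix, Matrix.of_apply, hi, if_true, (show i ≠ m2 by omega), if_false] at h
    rw [sum_mul_ite_ite _ (by omega) (by omega) (by omega)] at h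
    rw [hF i (by omega), hF (i + 1) (by omega)]
    linear_combination h
  obtain ⟨b, hb⟩ := exists_eq_of_mul_chain (fun i => F (σ₁ + 1 + i)) (m2 - σ₁) fun i hi => by
    have h := sum_hbDelta_mul_hbMatrix m2 σ₁ col ⟨σ₁ + i, by omega⟩
    simp only [hbMatrix, Matrix.of_apply, (show ¬ σ₁ + i < σ₁ by omega),
      (show σ₁ + i ≠ m2 by omega), if_false] at h
    rw [sum_mul_ite_ite _ (by omega) (by omega) (by omega)] at h
    simp only [show σ₁ + 1 + i = σ₁ + i + 1 by omega, show σ₁ + 1 + (i + 1) = σ₁ + i + 2 by omega]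
    rw [hF _ (by omega), hF _ (by omega)]
    linear_combination h
  refine ⟨a, b, fun i hi hi' => ?_, fun i hi => ?_⟩
  · rw [← hF, ha i hi']
  · rw [← hF, ← hb i (by omega)]

lemma isRelPrime_of_idealHeight {J : Ideal (MvPolynomial (Fin 2) k)} (hJ : idealHeight J = 2)
    {a b : MvPolynomial (Fin 2) k} (hab : J ≤ Ideal.span {a, b}) : IsRelPrime a b := by
  have hle : ∀ P : Ideal (MvPolynomial (Fin 2) k), P.IsPrime → J ≤ P → 2 ≤ P.height := by
    intro P hP hJP
    rw [← hJ, idealHeight]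
    refine (iInf₂_le ⟨P, hP⟩ hJP).trans ?_
    rw [← PrimeSpectrum.height_eq_orderHeight]
  have hone : ∀ P : Ideal (MvPolynomial (Fin 2) k), P.IsPrime → P.IsPrincipal → ¬ J ≤ P := by
    intro P hP hpr hJP
    have h1 := Ideal.height_le_one_of_isPrincipal_of_mem_minimalPrimes P P (by
      rw [Ideal.minimalPrimes_eq_subsingleton_self]; rfl)
    exact absurd ((hle P hP hJP).trans h1) (by decide)
  refine WfDvdMonoid.isRelPrime_of_no_irreducible_factors ?_ ?_
  · rintro ⟨rfl, rfl⟩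
    refine hone ⊥ Ideal.isPrime_bot bot_isPrincipal (hab.trans ?_)
    simp
  · intro π hπ ha hb
    have hp := hπ.prime
    refine hone (Ideal.span {π}) ((Ideal.span_singleton_prime hp.ne_zero).2 hp) ⟨⟨π, rfl⟩⟩
      (hab.trans ?_)
    rw [Ideal.span_le]
    rintro x (rfl | rfl)
    · exact Ideal.mem_span_singleton.2 ha
    · exact Ideal.mem_span_singleton.2 hb

lemma eq_pow_mul_pow_of_mem_pair_pow {R : Type*} [CommRing R] {u v x : R} {s : ℕ}
    (hx : x ∈ ({u, v} : Set R) ^ s) : ∃ i ≤ s, x = u ^ i * v ^ (s - i) := by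
  induction s generalizing x with
  | zero => exact ⟨0, le_rfl, by simpa using hx⟩
  | succ s ih =>
    rw [pow_succ] at hx
    obtain ⟨y, hy, z, hz, rfl⟩ := Set.mem_mul.1 hx
    obtain ⟨i, hi, rfl⟩ := ih hy
    rcases hz with rfl | rfl
    · exact ⟨i + 1, by omega, by rw [Nat.add_sub_add_right]; ring⟩
    · exact ⟨i, by omega, by rw [Nat.succ_sub hi, pow_succ]; ring⟩

lemma containsForms_X_pow (α : ℕ) :
    ContainsForms (Ideal.span {(X 0 : MvPolynomial (Fin 2) k), X 1} ^ α) α := by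
  induction α with
  | zero => intro f _; simp
  | succ α ih =>
    intro f hf
    obtain ⟨u, w, hu, hw, rfl⟩ := exists_eq_X_mul_add_X_mul_of_isHomogeneous hf
    rw [pow_succ']
    exact Ideal.add_mem _ (Ideal.mul_mem_mul (Ideal.subset_span (by simp)) (ih u hu))
      (Ideal.mul_mem_mul (Ideal.subset_span (by simp)) (ih w hw))

lemma X_pow_mul_span_singleton_le {J : Ideal (MvPolynomial (Fin 2) k)} {α : ℕ}
    {a : MvPolynomial (Fin 2) k} (h : ∀ i ≤ α, X 0 ^ i * X 1 ^ (α - i) * a ∈ J) :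
    Ideal.span {(X 0 : MvPolynomial (Fin 2) k), X 1} ^ α * Ideal.span {a} ≤ J := by
  rw [Ideal.span, Submodule.span_pow, ← Ideal.span, Ideal.span_mul_span', Ideal.span_le]
  rintro _ ⟨y, hy, z, rfl, rfl⟩
  obtain ⟨i, hi, rfl⟩ := eq_pow_mul_pow_of_mem_pair_pow hy
  exact h i hi

lemma homogeneousComponent_mem_pow_of_mem_span_pair_pow {J : Ideal (MvPolynomial (Fin 2) k)}
    {a b : MvPolynomial (Fin 2) k} {A B α β d : ℕ} (ha : a.IsHomogeneous A)
    (hb : b.IsHomogeneous B) (hA : A + α = d) (hB : B + β = d)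
    (haJ : ∀ i ≤ α, X 0 ^ i * X 1 ^ (α - i) * a ∈ J)
    (hbJ : ∀ i ≤ β, X 0 ^ i * X 1 ^ (β - i) * b ∈ J)
    {s e : ℕ} (he : s * d ≤ e) {f : MvPolynomial (Fin 2) k} (hf : f ∈ Ideal.span {a, b} ^ s) :
    homogeneousComponent e f ∈ J ^ s := by
  rw [Ideal.span, Submodule.span_pow] at hf
  suffices h : ∀ c, homogeneousComponent e (c * f) ∈ J ^ s by simpa using h 1
  induction hf using Submodule.span_induction with
  | zero => intro c; simp
  | add x y _ _ hx hy => intro c; rw [mul_add, map_add]; exact Ideal.add_mem _ (hx c) (hy c)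
  | smul r x _ hx => intro c; rw [smul_eq_mul, ← mul_assoc]; exact hx _
  | mem x hx =>
    intro c
    obtain ⟨i, hi, rfl⟩ := eq_pow_mul_pow_of_mem_pair_pow hx
    obtain ⟨j, rfl⟩ := Nat.exists_eq_add_of_le hi
    rw [Nat.add_sub_cancel_left]
    have hdeg : A * i + B * j + (α * i + β * j) ≤ e := by
      refine le_trans (le_of_eq ?_) he
      rw [add_mul]
      nth_rw 1 [← hA]
      rw [← hB]
      ring
    rw [homogeneousComponent_mul_of_isHomogeneous _ ((ha.pow i).mul (hb.pow j)),
      if_pos (by omega)]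
    have h1 := (containsForms_X_pow (k := k) (α * i + β * j)).mono
      (show α * i + β * j ≤ e - (A * i + B * j) by omega) _
      (homogeneousComponent_isHomogeneous (e - (A * i + B * j)) c)
    have h2 := Ideal.mul_mem_mul h1 (Ideal.mul_mem_mul
      (Ideal.pow_mem_pow (Ideal.mem_span_singleton_self a) i)
      (Ideal.pow_mem_pow (Ideal.mem_span_singleton_self b) j))
    refine (?_ : _ ≤ J ^ (i + j)) h2
    rw [pow_add, pow_mul, pow_mul, mul_mul_mul_comm, ← mul_pow, ← mul_pow, pow_add]
    exact Ideal.mul_mono (Ideal.pow_right_mono (X_pow_mul_span_singleton_le haJ) i)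
      (Ideal.pow_right_mono (X_pow_mul_span_singleton_le hbJ) j)

lemma span_forms_pow {ι : Type*} {g : ι → MvPolynomial (Fin 2) k} {d : ℕ}
    (hg : ∀ i, (g i).IsHomogeneous d) (s : ℕ) :
    Ideal.span {f | f ∈ Ideal.span (Set.range g) ^ s ∧ f.IsHomogeneous (s * d)} =
      Ideal.span (Set.range g) ^ s := by
  refine le_antisymm (Ideal.span_le.2 fun f hf => hf.1) ?_
  have hhom : ∀ s : ℕ, ∀ f ∈ Set.range g ^ s, f.IsHomogeneous (s * d) := by
    intro s
    induction s with
    | zero =>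
      intro f hf
      rw [show f = 1 by simpa using hf, zero_mul]
      exact isHomogeneous_one _ _
    | succ s ih =>
      intro f hf
      rw [pow_succ] at hf
      obtain ⟨y, hy, _, ⟨i, rfl⟩, rfl⟩ := Set.mem_mul.1 hf
      rw [add_mul, one_mul]
      exact (ih y hy).mul (hg i)
  conv_lhs => rw [Ideal.span, Submodule.span_pow]
  refine Submodule.span_mono fun f hf => ⟨?_, hhom s f hf⟩
  rw [Ideal.span, Submodule.span_pow]
  exact Submodule.subset_span hf

lemma le_of_isHomogeneous_of_mem {J : Ideal (MvPolynomial (Fin 2) k)} {D t : ℕ}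
    (hJ : Ideal.span {f | f ∈ J ∧ f.IsHomogeneous D} = J) {f : MvPolynomial (Fin 2) k}
    (hf : f ∈ J) (hft : f.IsHomogeneous t) (hf0 : f ≠ 0) : D ≤ t := by
  by_contra hlt
  refine hf0 ?_
  rw [← hJ] at hf
  rw [← homogeneousComponent_eq_self hft]
  suffices h : ∀ c, homogeneousComponent t (c * f) = 0 by simpa using h 1
  clear hft hf0
  induction hf using Submodule.span_induction with
  | zero => intro c; simp
  | add x y _ _ hx hy => intro c; rw [mul_add, map_add, hx c, hy c, add_zero]
  | smul r x _ hx => intro c; rw [smul_eq_mul, ← mul_assoc]; exact hx _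
  | mem x hx =>
    intro c
    rw [homogeneousComponent_mul_of_isHomogeneous _ hx.2, if_neg hlt, zero_mul]

/-- In degrees `e ≥ s d`, the power `I ^ s` contains all forms of degree `e` exactly when the
`s`-th power of the complete intersection attached to the linear part does. -/
lemma containsForms_hbIdeal_pow_iff {m2 σ₁ n : ℕ} (hσ : σ₁ ≤ m2) (hσ' : m2 - σ₁ ≤ σ₁)
    {col : Fin (m2 + 2) → MvPolynomial (Fin 2) k} (hcol : ∀ i, (col i).IsHomogeneous (n + 2))
    (hht : idealHeight (hbIdeal k m2 σ₁ col) = 2) (s e : ℕ) (he : (s + 1) * (n + 2 + m2) ≤ e) :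
    ContainsForms (hbIdeal k m2 σ₁ col ^ (s + 1)) e ↔
      n + (m2 - σ₁) + 1 + (s + 1) * (n + σ₁ + 2) ≤ e := by
  obtain ⟨a, b, ha, hb⟩ := exists_hbDelta_eq hσ col
  have hle : hbIdeal k m2 σ₁ col ≤ Ideal.span {a, b} := by
    rw [hbIdeal, Ideal.span_le]
    rintro _ ⟨⟨i, hi⟩, rfl⟩
    rcases Nat.lt_or_ge σ₁ i with h | h
    · obtain ⟨j, rfl⟩ := Nat.exists_eq_add_of_le h
      change hbDelta k m2 σ₁ col ⟨σ₁ + 1 + j, hi⟩ ∈ Ideal.span {a, b}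
      rw [hb j hi]
      exact Ideal.mul_mem_left _ _ (Ideal.subset_span (by simp))
    · rw [SetLike.mem_coe, ha i hi h]
      exact Ideal.mul_mem_left _ _ (Ideal.subset_span (by simp))
  have hab := isRelPrime_of_idealHeight hht hle
  have hahom : a.IsHomogeneous (n + (m2 - σ₁) + 2) := by
    refine isHomogeneous_of_X_pow_mul (i := 1) (j := σ₁) ?_
    have h1 := isHomogeneous_hbDelta (σ₁ := σ₁) hcol ⟨0, by omega⟩
    rw [ha 0 (by omega) (by omega)] at h1
    simpa [show n + (m2 - σ₁) + 2 + σ₁ = n + 2 + m2 by omega] using h1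
  have hbhom : b.IsHomogeneous (n + σ₁ + 2) := by
    refine isHomogeneous_of_X_pow_mul (i := 1) (j := m2 - σ₁) ?_
    have h1 := isHomogeneous_hbDelta (σ₁ := σ₁) hcol ⟨σ₁ + 1 + 0, by omega⟩
    rw [hb 0 (by omega)] at h1
    simpa [show n + σ₁ + 2 + (m2 - σ₁) = n + 2 + m2 by omega] using h1
  have hiff : ContainsForms (hbIdeal k m2 σ₁ col ^ (s + 1)) e ↔
      ContainsForms (Ideal.span {a, b} ^ (s + 1)) e := by
    refine ⟨fun h f hf => Ideal.pow_right_mono hle _ (h f hf), fun h f hf => ?_⟩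
    rw [← homogeneousComponent_eq_self hf]
    refine homogeneousComponent_mem_pow_of_mem_span_pair_pow hahom hbhom (α := σ₁)
      (β := m2 - σ₁) (d := n + 2 + m2) (by omega) (by omega) (fun i hi => ?_) (fun i hi => ?_)
      he (h f hf)
    · rw [← ha i (by omega) hi]
      exact Ideal.subset_span ⟨_, rfl⟩
    · rw [← hb i (by omega)]
      exact Ideal.subset_span ⟨_, rfl⟩
  rw [hiff]
  constructor
  · intro h
    by_contra hlt
    exact not_containsForms_span_pair_pow hahom hbhom hab s (h.mono (by omega))
  · intro h
    exact (containsForms_span_pair_pow (by omega) hahom hbhom hab s).mono h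

end HilbertBurch

section Regularity

variable {k : Type*} [Field k]

lemma sup_twists_of_containsForms {J : Ideal (MvPolynomial (Fin 2) k)} {p q D N : ℕ}
    {t1 : Fin q → ℕ} (h : HasMinimalGradedResolution J (fun _ : Fin p => D) t1)
    (hN : ContainsForms J N) : (Finset.univ.sup fun _ : Fin p => D) = D := by
  obtain ⟨g, -, -, hg, -⟩ := h
  rcases Nat.eq_zero_or_pos p with rfl | hp
  · have hJ : J = ⊥ := by rw [← hg, Set.range_eq_empty, Ideal.span_empty]
    have hX : (X 0 : MvPolynomial (Fin 2) k) ^ N ∈ J :=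
      hN _ (by simpa using (isHomogeneous_X k (0 : Fin 2)).pow N)
    rw [hJ, Ideal.mem_bot] at hX
    exact absurd hX (pow_ne_zero _ (X_ne_zero _))
  · exact Finset.sup_const ⟨⟨0, hp⟩, Finset.mem_univ _⟩ D

/-- An ideal generated by forms of degree `D` has regularity `r > D` as soon as `r` is the
smallest degree at which it contains all forms. -/
lemma hasRegularity_of_containsForms {J : Ideal (MvPolynomial (Fin 2) k)} {D r : ℕ}
    (hJ : Ideal.span {f | f ∈ J ∧ f.IsHomogeneous D} = J) (hDr : D ≤ r)
    (h : ContainsForms J (r + 1)) (h' : ¬ ContainsForms J r) :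
    HasRegularity J ((r + 1 : ℕ) : ℤ) := by
  obtain ⟨p, q, t1, hres⟩ := exists_minimal_resolution J D hJ
  refine ⟨p, q, _, t1, hres, ?_⟩
  have hle := twists_le_of_containsForms hres (Nat.le_succ_of_le hDr) h
  have hsup : Finset.univ.sup t1 = r + 2 := by
    apply le_antisymm (Finset.sup_le fun j _ => hle j)
    by_contra! hlt
    refine h' (containsForms_of_twists_le hres hDr (fun j => ?_) h)
    have := Finset.le_sup (f := t1) (Finset.mem_univ j)
    omega
  rw [regOfTwists, sup_twists_of_containsForms hres h, hsup]
  push_cast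
  omega

/-- An ideal generated by forms of degree `D` and containing all forms of some degree has
regularity `D` if and only if it contains all forms of degree `D`. -/
lemma hasRegularity_iff_containsForms {J : Ideal (MvPolynomial (Fin 2) k)} {D N : ℕ}
    (hJ : Ideal.span {f | f ∈ J ∧ f.IsHomogeneous D} = J) (hN : ContainsForms J N) :
    HasRegularity J (D : ℤ) ↔ ContainsForms J D := by
  constructor
  · rintro ⟨p, q, t0, t1, hres, hreg⟩
    rw [regOfTwists] at hreg
    have ht0 : t0 = fun _ => D := by
      obtain ⟨g, -, hgh, hg, hmin, -⟩ := hres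
      funext j
      apply le_antisymm
      · have := Finset.le_sup (f := t0) (Finset.mem_univ j)
        omega
      · refine le_of_isHomogeneous_of_mem hJ (hg ▸ Ideal.subset_span ⟨j, rfl⟩) (hgh j) fun h0 => ?_
        exact hmin j (h0 ▸ Ideal.zero_mem _)
    subst ht0
    refine containsForms_of_twists_le hres le_rfl (fun j => ?_) hN
    have := Finset.le_sup (f := t1) (Finset.mem_univ j)
    omega
  · intro h
    obtain ⟨p, q, t1, hres⟩ := exists_minimal_resolution J D hJ
    refine ⟨p, q, _, t1, hres, ?_⟩
    have hsup : Finset.univ.sup t1 ≤ D + 1 :=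
      Finset.sup_le fun j _ => twists_le_of_containsForms hres le_rfl h j
    rw [regOfTwists, sup_twists_of_containsForms hres hN]
    omega

end Regularity

/-!
STATEMENT 7 (Corollary C2.7).  With the almost linearly presented setup above and
`d = n + m − 2`:
(1) if `ρ = 1` then `reg I^s = sd + n − 1` for all `s ≥ 1`;
(2) if `ρ = 2` then `reg I^s = sd` if and only if `(n−1)/σ₂ + 1 ≤ s`.
-/

theorem regularity_of_powers_almost_linearly_presented
    {k : Type*} [Field k] (m2 σ₁ σ₂ ρ n : ℕ)
    (hdata : ScrollData m2 σ₁ σ₂ ρ n)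
    (col : Fin (m2 + 2) → MvPolynomial (Fin 2) k)
    (hI : ScrollIdealData k m2 σ₁ n col)
    (d : ℕ) (hd : d = n + m2)
    (s : ℕ) (hs : 1 ≤ s) :
    (ρ = 1 → HasRegularity ((hbIdeal k m2 σ₁ col) ^ s) ((s : ℤ) * d + n - 1)) ∧
    (ρ = 2 → (HasRegularity ((hbIdeal k m2 σ₁ col) ^ s) ((s : ℤ) * d) ↔
      ((n : ℚ) - 1) / (σ₂ : ℚ) + 1 ≤ (s : ℚ))) := by
  obtain ⟨-, hn, hρ⟩ := hdata
  obtain ⟨hcol, hht, -⟩ := hI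
  obtain ⟨n, rfl⟩ := Nat.exists_eq_add_of_le' hn
  obtain ⟨s, rfl⟩ := Nat.exists_eq_add_of_le' hs
  subst hd
  have hσ : σ₁ ≤ m2 := by omega
  have hσ' : m2 - σ₁ ≤ σ₁ := by omega
  have hiff := containsForms_hbIdeal_pow_iff hσ hσ' hcol hht s
  have hJ : Ideal.span {f | f ∈ hbIdeal k m2 σ₁ col ^ (s + 1) ∧
      f.IsHomogeneous ((s + 1) * (n + 2 + m2))} = hbIdeal k m2 σ₁ col ^ (s + 1) :=
    span_forms_pow (isHomogeneous_hbDelta hcol) (s + 1)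
  constructor
  · intro h1
    obtain rfl : σ₁ = m2 := by omega
    convert hasRegularity_of_containsForms (r := (s + 1) * (n + 2 + σ₁) + n) hJ
      (Nat.le_add_right _ _) ((hiff _ ?_).2 ?_) (mt (hiff _ ?_).1 ?_) using 1
    · push_cast
      ring
    all_goals
      have : (s + 1) * (n + σ₁ + 2) = (s + 1) * (n + 2 + σ₁) := by ring
      omega
  · intro h2
    obtain ⟨-, hσ₂, -, rfl⟩ : ρ = 2 ∧ 1 ≤ σ₂ ∧ σ₂ ≤ σ₁ ∧ σ₁ + σ₂ = m2 := by omega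
    rw [Nat.add_sub_cancel_left] at hiff
    have hD := hiff ((s + 1) * (n + 2 + (σ₁ + σ₂))) le_rfl
    have hN := (hiff ((s + 1) * (n + 2 + (σ₁ + σ₂)) + (n + σ₂ + 1)) (Nat.le_add_right _ _)).2
      (by nlinarith [Nat.zero_le ((s + 1) * σ₂)])
    have hreg := hasRegularity_iff_containsForms hJ hN
    push_cast at hreg ⊢
    rw [hreg, hD]
    have hpos : (0 : ℚ) < σ₂ := by exact_mod_cast hσ₂
    rw [add_le_add_iff_right, div_le_iff₀ hpos, ← Nat.cast_le (α := ℚ)]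
    push_cast
    constructor <;> intro h <;> linarith
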